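/- arXiv:2309.06658 — 8 statements merged into one kernel-verified Lean document; each statement's English description precedes it below -/
import Mathlib

section
/- Let Q be a symmetric negative definite p×p real matrix, S a p×m real matrix, and R a symmetric m×m real matrix, and let β ∈ ℝ. Let u : ℕ → ℝ^m and y : ℕ → ℝ^p be sequences such that for every T ∈ ℕ, Σ_{k=0}^{T} ( y_kᵀ Q y_k + y_kᵀ S u_k + u_kᵀ R u_k ) ≥ β. If u is square-summable, then y is square-summable. -/
open Matrix

/-- The Frobenius bound `‖M v‖² ≤ ‖M‖² ‖v‖²`, in coordinates. -/
theorem Matrix.mulVec_dotProduct_self_le {m n : Type*} [Fintype m] [Fintype n]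
    (M : Matrix m n ℝ) (v : n → ℝ) :
    M *ᵥ v ⬝ᵥ M *ᵥ v ≤ (∑ i, ∑ j, M i j ^ 2) * (v ⬝ᵥ v) := by
  have hv : v ⬝ᵥ v = ∑ j, v j ^ 2 := by simp only [dotProduct, sq]
  rw [hv, Finset.sum_mul]
  refine Finset.sum_le_sum fun i _ => ?_
  rw [← sq]
  exact Finset.sum_mul_sq_le_sq_mul_sq _ _ _

/-- Young's inequality for the real dot product. -/
theorem dotProduct_le_young {n : Type*} [Fintype n] {δ : ℝ} (hδ : 0 < δ) (x z : n → ℝ) :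
    x ⬝ᵥ z ≤ δ * (x ⬝ᵥ x) + δ⁻¹ * (z ⬝ᵥ z) := by
  simp only [dotProduct, Finset.mul_sum, ← Finset.sum_add_distrib]
  refine Finset.sum_le_sum fun i _ => ?_
  have h : 0 ≤ δ⁻¹ * ((δ * x i - z i) ^ 2 + (δ * x i) ^ 2 + z i ^ 2) := by positivity
  have e : δ⁻¹ * ((δ * x i - z i) ^ 2 + (δ * x i) ^ 2 + z i ^ 2) =
      2 * (δ * (x i * x i) + δ⁻¹ * (z i * z i) - x i * z i) := by
    field_simp
    ring
  linarith

open scoped MatrixOrder in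
/-- A positive definite real quadratic form is coercive. -/
theorem Matrix.PosDef.exists_pos_mul_le {n : Type*} [Fintype n] {A : Matrix n n ℝ}
    (hA : A.PosDef) : ∃ ε > 0, ∀ x : n → ℝ, ε * (x ⬝ᵥ x) ≤ x ⬝ᵥ A *ᵥ x := by
  classical
  obtain ⟨B, rfl⟩ := CStarAlgebra.nonneg_iff_eq_star_mul_self.mp hA.posSemidef.nonneg
  rw [star_eq_conjTranspose] at hA ⊢
  have hB : IsUnit B.det := by
    have h := (isUnit_iff_isUnit_det _).mp hA.isUnit
    rw [det_mul] at h
    exact isUnit_of_mul_isUnit_right h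
  set C := ∑ i, ∑ j, B⁻¹ i j ^ 2 with hC
  have hC0 : 0 ≤ C := by positivity
  refine ⟨(C + 1)⁻¹, by positivity, fun x => ?_⟩
  have hx : B⁻¹ *ᵥ B *ᵥ x = x := by
    rw [mulVec_mulVec, nonsing_inv_mul _ hB, one_mulVec]
  have hBx : x ⬝ᵥ (Bᴴ * B) *ᵥ x = B *ᵥ x ⬝ᵥ B *ᵥ x := by
    rw [← mulVec_mulVec, dotProduct_mulVec, conjTranspose_eq_transpose_of_trivial,
      vecMul_transpose]
  have h := mulVec_dotProduct_self_le B⁻¹ (B *ᵥ x)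
  have h0 : 0 ≤ B *ᵥ x ⬝ᵥ B *ᵥ x := Finset.sum_nonneg fun i _ => mul_self_nonneg _
  rw [hx, ← hC] at h
  rw [hBx, inv_mul_le_iff₀ (by positivity)]
  linarith

/-- QSR input–output stability (discrete-sequence form): if `Q ≺ 0` and the
QSR dissipation inequality holds for all truncations, then square-summability
of the input `u` implies square-summability of the output `y`. -/
theorem qsr_io_stability {p m : ℕ}
    (Q : Matrix (Fin p) (Fin p) ℝ) (S : Matrix (Fin p) (Fin m) ℝ)
    (R : Matrix (Fin m) (Fin m) ℝ) (β : ℝ)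
    (hQ : (-Q).PosDef) (hR : R.IsSymm)
    (u : ℕ → Fin m → ℝ) (y : ℕ → Fin p → ℝ)
    (hdiss : ∀ T : ℕ,
      ∑ k ∈ Finset.range (T + 1),
        (y k ⬝ᵥ Q *ᵥ y k + y k ⬝ᵥ S *ᵥ u k + u k ⬝ᵥ R *ᵥ u k) ≥ β)
    (hu : Summable fun k => ∑ i, u k i ^ 2) :
    Summable fun k => ∑ i, y k i ^ 2 := by
  have dot_self : ∀ {n : ℕ} (v : Fin n → ℝ), ∑ i, v i ^ 2 = v ⬝ᵥ v := fun v => by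
    simp only [dotProduct, sq]
  have dot_nonneg : ∀ {n : ℕ} (v : Fin n → ℝ), 0 ≤ v ⬝ᵥ v := fun v =>
    Finset.sum_nonneg fun i _ => mul_self_nonneg _
  simp only [dot_self] at hu ⊢
  obtain ⟨ε, hε, hcoer⟩ := hQ.exists_pos_mul_le
  obtain ⟨C, hC0, hC⟩ : ∃ C : ℝ, 0 ≤ C ∧ ∀ k,
      y k ⬝ᵥ Q *ᵥ y k + y k ⬝ᵥ S *ᵥ u k + u k ⬝ᵥ R *ᵥ u k ≤
        -(ε / 2) * (y k ⬝ᵥ y k) + C * (u k ⬝ᵥ u k) := by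
    refine ⟨(ε / 2)⁻¹ * (∑ i, ∑ j, S i j ^ 2) + (1 + ∑ i, ∑ j, R i j ^ 2), by positivity,
      fun k => ?_⟩
    have h1 := hcoer (y k)
    rw [neg_mulVec, dotProduct_neg] at h1
    have h2 := dotProduct_le_young (half_pos hε) (y k) (S *ᵥ u k)
    have h3 := dotProduct_le_young one_pos (u k) (R *ᵥ u k)
    have h4 := mul_le_mul_of_nonneg_left (mulVec_dotProduct_self_le S (u k))
      (inv_nonneg.mpr (half_pos hε).le)
    have h5 := mulVec_dotProduct_self_le R (u k)
    rw [inv_one] at h3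
    linarith
  refine summable_of_sum_range_le (c := (ε / 2)⁻¹ * (C * ∑' k, u k ⬝ᵥ u k - β))
    (fun k => dot_nonneg _) fun T => ?_
  have hsum := (hdiss T).le.trans (Finset.sum_le_sum fun k _ => hC k)
  rw [Finset.sum_add_distrib, ← Finset.mul_sum, ← Finset.mul_sum] at hsum
  have htsum := mul_le_mul_of_nonneg_left
    (hu.sum_le_tsum (Finset.range (T + 1)) fun k _ => dot_nonneg _) hC0
  have hlast := Finset.sum_range_succ (fun k => y k ⬝ᵥ y k) T
  have hT := dot_nonneg (y T)
  calc ∑ k ∈ Finset.range T, y k ⬝ᵥ y k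
      ≤ ∑ k ∈ Finset.range (T + 1), y k ⬝ᵥ y k := by linarith
    _ ≤ _ := by
      rw [← div_eq_inv_mul, le_div_iff₀ (half_pos hε)]
      linarith
end

section
/- Let Q₁ be a symmetric p×p real matrix, S₁ a p×m real matrix, R₁ a symmetric m×m real matrix, Q₂ a symmetric m×m real matrix, S₂ an m×p real matrix, and R₂ a symmetric p×p real matrix. Let r₁, u₁ : ℕ → ℝ^m, y₁ : ℕ → ℝ^p, r₂, u₂ : ℕ → ℝ^p, y₂ : ℕ → ℝ^m be sequences satisfying the negative feedback interconnection u₁ₖ = r₁ₖ − y₂ₖ and u₂ₖ = r₂ₖ + y₁ₖ for all k. Suppose there exist β₁, β₂ ∈ ℝ such that for every T ∈ ℕ, Σ_{k=0}^{T} ( y₁ₖᵀ Q₁ y₁ₖ + y₁ₖᵀ S₁ u₁ₖ + u₁ₖᵀ R₁ u₁ₖ ) ≥ β₁ and Σ_{k=0}^{T} ( y₂ₖᵀ Q₂ y₂ₖ + y₂ₖᵀ S₂ u₂ₖ + u₂ₖᵀ R₂ u₂ₖ ) ≥ β₂. Suppose further there exists α > 0 such that the block matrix [[Q₁ + α R₂,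 −S₁ + α S₂ᵀ], [(−S₁ + α S₂ᵀ)ᵀ, R₁ + α Q₂]] is negative definite. Then if r₁ and r₂ are square-summable, y₁ and y₂ are square-summable. -/
open Matrix

/-- The Euclidean operator bound of a real matrix by its Frobenius norm, in terms of dot products. -/
lemma dotProduct_mulVec_self_le {ι κ : Type*} [Fintype ι] [Fintype κ]
    (M : Matrix ι κ ℝ) (x : κ → ℝ) :
    (M *ᵥ x) ⬝ᵥ (M *ᵥ x) ≤ (∑ i, ∑ j, M i j ^ 2) * (x ⬝ᵥ x) := by
  simp only [dotProduct, Matrix.mulVec, ← pow_two]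
  rw [Finset.sum_mul]
  exact Finset.sum_le_sum fun i _ => Finset.sum_mul_sq_le_sq_mul_sq _ _ _

lemma exists_dotProduct_mulVec_le {ι κ : Type*} [Fintype ι] [Fintype κ]
    (M : Matrix ι κ ℝ) {ε : ℝ} (hε : 0 < ε) :
    ∃ C : ℝ, ∀ x y, x ⬝ᵥ M *ᵥ y ≤ ε * (x ⬝ᵥ x) + C * (y ⬝ᵥ y) := by
  refine ⟨1 / (4 * ε) * ∑ i, ∑ j, M i j ^ 2, fun x y => ?_⟩
  have young (v : ι → ℝ) : x ⬝ᵥ v ≤ ε * (x ⬝ᵥ x) + 1 / (4 * ε) * (v ⬝ᵥ v) := by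
    simp only [dotProduct, Finset.mul_sum, ← Finset.sum_add_distrib]
    refine Finset.sum_le_sum fun i _ => ?_
    have h : ε * (x i * x i) + 1 / (4 * ε) * (v i * v i) - x i * v i
        = (2 * ε * x i - v i) ^ 2 / (4 * ε) := by
      field_simp
      ring
    have : 0 ≤ (2 * ε * x i - v i) ^ 2 / (4 * ε) := by positivity
    linarith
  refine (young _).trans ?_
  rw [mul_assoc]
  gcongr
  exact dotProduct_mulVec_self_le M y

open scoped MatrixOrder in
/-- A real positive definite matrix is coercive. -/
lemma Matrix.PosDef.exists_le_dotProduct_mulVec {ι : Type*} [Fintype ι] [DecidableEq ι]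
    {N : Matrix ι ι ℝ} (hN : N.PosDef) :
    ∃ c > 0, ∀ x, c * (x ⬝ᵥ x) ≤ x ⬝ᵥ N *ᵥ x := by
  obtain ⟨B, rfl⟩ := CStarAlgebra.nonneg_iff_eq_star_mul_self.mp hN.posSemidef.nonneg
  have hB : IsUnit B.det :=
    isUnit_of_mul_isUnit_right (det_mul (star B) B ▸ (isUnit_iff_isUnit_det _).mp hN.isUnit)
  set C := ∑ i, ∑ j, B⁻¹ i j ^ 2
  have hC : 0 ≤ C := by positivity
  refine ⟨1 / (C + 1), by positivity, fun x => ?_⟩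
  have h := dotProduct_mulVec_self_le B⁻¹ (B *ᵥ x)
  rw [mulVec_mulVec, nonsing_inv_mul _ hB, one_mulVec] at h
  have hq : x ⬝ᵥ (star B * B) *ᵥ x = (B *ᵥ x) ⬝ᵥ (B *ᵥ x) := by
    rw [← mulVec_mulVec, star_eq_conjTranspose, conjTranspose_eq_transpose_of_trivial,
      dotProduct_transpose_mulVec]
  have hpos : 0 ≤ (B *ᵥ x) ⬝ᵥ (B *ᵥ x) := Finset.sum_nonneg fun i _ => mul_self_nonneg _
  rw [hq, one_div, inv_mul_le_iff₀ (by positivity)]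
  linarith

lemma dotProduct_fromBlocks_mulVec {ι κ : Type*} [Fintype ι] [Fintype κ]
    (A : Matrix ι ι ℝ) (B : Matrix ι κ ℝ) (D : Matrix κ κ ℝ) (x : ι → ℝ) (y : κ → ℝ) :
    Sum.elim x y ⬝ᵥ fromBlocks A B Bᵀ D *ᵥ Sum.elim x y
      = x ⬝ᵥ A *ᵥ x + 2 * (x ⬝ᵥ B *ᵥ y) + y ⬝ᵥ D *ᵥ y := by
  rw [fromBlocks_mulVec]
  simp only [Sum.elim_comp_inl, Sum.elim_comp_inr, sumElim_dotProduct_sumElim, dotProduct_add]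
  rw [dotProduct_transpose_mulVec]
  ring

/-- Halving the off-diagonal blocks of a negative definite matrix preserves coercivity. -/
lemma exists_coercive_of_posDef_neg_fromBlocks {ι κ : Type*} [Fintype ι] [Fintype κ]
    [DecidableEq ι] [DecidableEq κ]
    {A : Matrix ι ι ℝ} {B : Matrix ι κ ℝ} {D : Matrix κ κ ℝ}
    (h : (-(fromBlocks A B Bᵀ D)).PosDef) :
    ∃ c > 0, ∀ x y, x ⬝ᵥ A *ᵥ x + x ⬝ᵥ B *ᵥ y + y ⬝ᵥ D *ᵥ y
      ≤ -(c * (x ⬝ᵥ x + y ⬝ᵥ y)) := by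
  obtain ⟨c, hc, hle⟩ := h.exists_le_dotProduct_mulVec
  refine ⟨c, hc, fun x y => ?_⟩
  have h₁ := hle (Sum.elim x y)
  have h₂ := hle (Sum.elim x (-y))
  rw [neg_mulVec, dotProduct_neg, dotProduct_fromBlocks_mulVec,
    sumElim_dotProduct_sumElim] at h₁ h₂
  simp only [mulVec_neg, dotProduct_neg, neg_dotProduct, neg_neg] at h₂
  linarith

lemma Matrix.IsSymm.dotProduct_mulVec_comm {ι : Type*} [Fintype ι] {M : Matrix ι ι ℝ}
    (hM : M.IsSymm) (x y : ι → ℝ) : x ⬝ᵥ M *ᵥ y = y ⬝ᵥ M *ᵥ x := by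
  rw [← dotProduct_transpose_mulVec, hM.eq]

/-- If `c * f` exceeds a summable sequence by at most `-w`, where the partial sums of `w` are
bounded below, then the nonnegative sequence `f` is summable. -/
lemma summable_of_mul_le_sub {f w g : ℕ → ℝ} {c β : ℝ} (hc : 0 < c) (hf : ∀ k, 0 ≤ f k)
    (hg : Summable g) (hg₀ : ∀ k, 0 ≤ g k)
    (hw : ∀ T, β ≤ ∑ k ∈ Finset.range (T + 1), w k)
    (h : ∀ k, c * f k ≤ g k - w k) : Summable f := by
  refine summable_of_sum_range_le (c := (∑' k, g k - β) / c) hf fun n => ?_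
  rw [le_div_iff₀ hc]
  calc (∑ k ∈ Finset.range n, f k) * c
      ≤ (∑ k ∈ Finset.range (n + 1), f k) * c := by
        rw [Finset.sum_range_succ]
        nlinarith [hf n]
    _ = ∑ k ∈ Finset.range (n + 1), c * f k := by rw [mul_comm, Finset.mul_sum]
    _ ≤ ∑ k ∈ Finset.range (n + 1), (g k - w k) := Finset.sum_le_sum fun k _ => h k
    _ ≤ ∑' k, g k - β := by
        rw [Finset.sum_sub_distrib]
        exact sub_le_sub (hg.sum_le_tsum _ fun k _ => hg₀ k) (hw n)

/-- QSR input–output stability theorem for two QSR-dissipative systems in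
negative feedback (discrete-sequence form). -/
theorem qsr_feedback_io_stability {p m : ℕ}
    (Q₁ : Matrix (Fin p) (Fin p) ℝ) (S₁ : Matrix (Fin p) (Fin m) ℝ)
    (R₁ : Matrix (Fin m) (Fin m) ℝ)
    (Q₂ : Matrix (Fin m) (Fin m) ℝ) (S₂ : Matrix (Fin m) (Fin p) ℝ)
    (R₂ : Matrix (Fin p) (Fin p) ℝ)
    (hQ₁ : Q₁.IsSymm) (hR₁ : R₁.IsSymm) (hQ₂ : Q₂.IsSymm) (hR₂ : R₂.IsSymm)
    (r₁ u₁ : ℕ → Fin m → ℝ) (y₁ : ℕ → Fin p → ℝ)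
    (r₂ u₂ : ℕ → Fin p → ℝ) (y₂ : ℕ → Fin m → ℝ)
    (hu₁ : ∀ k, u₁ k = r₁ k - y₂ k)
    (hu₂ : ∀ k, u₂ k = r₂ k + y₁ k)
    (β₁ β₂ : ℝ)
    (hdiss₁ : ∀ T : ℕ,
      ∑ k ∈ Finset.range (T + 1),
        (y₁ k ⬝ᵥ Q₁ *ᵥ y₁ k + y₁ k ⬝ᵥ S₁ *ᵥ u₁ k + u₁ k ⬝ᵥ R₁ *ᵥ u₁ k) ≥ β₁)
    (hdiss₂ : ∀ T : ℕ,
      ∑ k ∈ Finset.range (T + 1),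
        (y₂ k ⬝ᵥ Q₂ *ᵥ y₂ k + y₂ k ⬝ᵥ S₂ *ᵥ u₂ k + u₂ k ⬝ᵥ R₂ *ᵥ u₂ k) ≥ β₂)
    (α : ℝ) (hα : 0 < α)
    (hLMI : (-(Matrix.fromBlocks (Q₁ + α • R₂) (-S₁ + α • S₂ᵀ)
        (-S₁ + α • S₂ᵀ)ᵀ (R₁ + α • Q₂))).PosDef)
    (hr₁ : Summable fun k => ∑ i, r₁ k i ^ 2)
    (hr₂ : Summable fun k => ∑ i, r₂ k i ^ 2) :
    (Summable fun k => ∑ i, y₁ k i ^ 2) ∧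
      (Summable fun k => ∑ i, y₂ k i ^ 2) := by
  obtain ⟨c, hc, hneg⟩ := exists_coercive_of_posDef_neg_fromBlocks hLMI
  have hc4 : 0 < c / 4 := by positivity
  obtain ⟨a₁, ha₁⟩ := exists_dotProduct_mulVec_le S₁ hc4
  obtain ⟨a₂, ha₂⟩ := exists_dotProduct_mulVec_le ((-2 : ℝ) • R₁) hc4
  obtain ⟨a₃, ha₃⟩ := exists_dotProduct_mulVec_le R₁ one_pos
  obtain ⟨b₁, hb₁⟩ := exists_dotProduct_mulVec_le (α • S₂) hc4
  obtain ⟨b₂, hb₂⟩ := exists_dotProduct_mulVec_le ((2 * α) • R₂) hc4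
  obtain ⟨b₃, hb₃⟩ := exists_dotProduct_mulVec_le (α • R₂) one_pos
  have sq_dot {n : ℕ} (v : Fin n → ℝ) : ∑ i, v i ^ 2 = v ⬝ᵥ v := by
    simp only [dotProduct, pow_two]
  have dot_nonneg {n : ℕ} (v : Fin n → ℝ) : 0 ≤ v ⬝ᵥ v :=
    Finset.sum_nonneg fun i _ => mul_self_nonneg _
  simp only [sq_dot] at hr₁ hr₂ ⊢
  have hy : Summable fun k => y₁ k ⬝ᵥ y₁ k + y₂ k ⬝ᵥ y₂ k := by
    refine summable_of_mul_le_sub (c := c / 2) (β := β₁ + α * β₂)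
      (w := fun k =>
        (y₁ k ⬝ᵥ Q₁ *ᵥ y₁ k + y₁ k ⬝ᵥ S₁ *ᵥ u₁ k + u₁ k ⬝ᵥ R₁ *ᵥ u₁ k)
        + α * (y₂ k ⬝ᵥ Q₂ *ᵥ y₂ k + y₂ k ⬝ᵥ S₂ *ᵥ u₂ k + u₂ k ⬝ᵥ R₂ *ᵥ u₂ k))
      (g := fun k => |a₁ + a₂ + (1 + a₃)| * (r₁ k ⬝ᵥ r₁ k)
        + |b₁ + b₂ + (1 + b₃)| * (r₂ k ⬝ᵥ r₂ k))
      (by positivity) (fun k => add_nonneg (dot_nonneg _) (dot_nonneg _))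
      ((hr₁.mul_left _).add (hr₂.mul_left _))
      (fun k => add_nonneg (mul_nonneg (abs_nonneg _) (dot_nonneg _))
        (mul_nonneg (abs_nonneg _) (dot_nonneg _)))
      (fun T => ?_) (fun k => ?_)
    · rw [Finset.sum_add_distrib, ← Finset.mul_sum]
      exact add_le_add (hdiss₁ T) (mul_le_mul_of_nonneg_left (hdiss₂ T) hα.le)
    · have h := hneg (y₁ k) (y₂ k)
      have e₁ := ha₁ (y₁ k) (r₁ k)
      have e₂ := ha₂ (y₂ k) (r₁ k)
      have e₃ := ha₃ (r₁ k) (r₁ k)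
      have f₁ := hb₁ (y₂ k) (r₂ k)
      have f₂ := hb₂ (y₁ k) (r₂ k)
      have f₃ := hb₃ (r₂ k) (r₂ k)
      have g₁ := mul_le_mul_of_nonneg_right (le_abs_self (a₁ + a₂ + (1 + a₃)))
        (dot_nonneg (r₁ k))
      have g₂ := mul_le_mul_of_nonneg_right (le_abs_self (b₁ + b₂ + (1 + b₃)))
        (dot_nonneg (r₂ k))
      have s₁ := hR₁.dotProduct_mulVec_comm (r₁ k) (y₂ k)
      have s₂ := hR₂.dotProduct_mulVec_comm (r₂ k) (y₁ k)
      simp only [hu₁, hu₂, add_mulVec, neg_mulVec, smul_mulVec, mulVec_add, mulVec_sub,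
        dotProduct_add, dotProduct_sub, add_dotProduct, sub_dotProduct, dotProduct_neg,
        dotProduct_smul, smul_eq_mul, dotProduct_transpose_mulVec, s₁, s₂] at h e₂ f₁ f₂ f₃ ⊢
      linarith
  exact ⟨hy.of_nonneg_of_le (fun k => dot_nonneg _) fun k => le_add_of_nonneg_right (dot_nonneg _),
    hy.of_nonneg_of_le (fun k => dot_nonneg _) fun k => le_add_of_nonneg_left (dot_nonneg _)⟩
end

section
/- Let A, B, C, D be real matrices of sizes n×n, n×m, m×n, m×m respectively, and let P be a symmetric positive definite n×n real matrix such that the block matrix [[AᵀPA − P, AᵀPB − Cᵀ], [BᵀPA − C, BᵀPB − (Dᵀ + D)]] is negative semidefinite. Then for every input sequence u : ℕ → ℝ^m and every state trajectory x : ℕ → ℝ^n with x_{k+1} = A x_k + B u_k and output y_k = C x_k + D u_k, and for every T ∈ ℕ, Σ_{k=0}^{T} ( u_kᵀ y_k + y_kᵀ u_k ) ≥ x_{T+1}ᵀ P x_{T+1} − x₀ᵀ P x₀; in particular, if x₀ = 0 then Σ_{k=0}^{T} ( u_kᵀ y_k + y_kᵀ u_k ) ≥ 0. -/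
open Matrix

theorem dotProduct_transpose_mulVec_eq_mulVec_dotProduct {ι κ R : Type*} [Fintype ι]
    [Fintype κ] [CommSemiring R] (M : Matrix ι κ R) (v : κ → R) (w : ι → R) :
    v ⬝ᵥ Mᵀ *ᵥ w = (M *ᵥ v) ⬝ᵥ w := by
  rw [dotProduct_transpose_mulVec, dotProduct_comm]

/-- The quadratic form of the KYP matrix is the storage increment minus the supply. -/
theorem dotProduct_kypMatrix_mulVec {ι κ R : Type*} [Fintype ι] [Fintype κ] [CommRing R]
    (A : Matrix ι ι R) (B : Matrix ι κ R) (C : Matrix κ ι R) (D : Matrix κ κ R)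
    (P : Matrix ι ι R) (x : ι → R) (u : κ → R) :
    Sum.elim x u ⬝ᵥ Matrix.fromBlocks (Aᵀ * P * A - P) (Aᵀ * P * B - Cᵀ)
        (Bᵀ * P * A - C) (Bᵀ * P * B - (Dᵀ + D)) *ᵥ Sum.elim x u =
      (A *ᵥ x + B *ᵥ u) ⬝ᵥ P *ᵥ (A *ᵥ x + B *ᵥ u) - x ⬝ᵥ P *ᵥ x -
        (u ⬝ᵥ (C *ᵥ x + D *ᵥ u) + (C *ᵥ x + D *ᵥ u) ⬝ᵥ u) := by
  simp only [fromBlocks_mulVec, Sum.elim_comp_inl, Sum.elim_comp_inr,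
    sumElim_dotProduct_sumElim, sub_mulVec, add_mulVec, mulVec_add, ← mulVec_mulVec,
    dotProduct_add, dotProduct_sub, add_dotProduct,
    dotProduct_transpose_mulVec_eq_mulVec_dotProduct]
  ring

/-- Sufficiency direction of the discrete-time KYP lemma: feasibility of the
KYP LMI implies the passivity dissipation inequality along every trajectory
of the discrete LTI system `(A, B, C, D)`. -/
theorem discrete_kyp_passivity {n m : ℕ}
    (A : Matrix (Fin n) (Fin n) ℝ) (B : Matrix (Fin n) (Fin m) ℝ)
    (C : Matrix (Fin m) (Fin n) ℝ) (D : Matrix (Fin m) (Fin m) ℝ)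
    (P : Matrix (Fin n) (Fin n) ℝ) (hP : P.PosDef)
    (hLMI : (-(Matrix.fromBlocks (Aᵀ * P * A - P) (Aᵀ * P * B - Cᵀ)
        (Bᵀ * P * A - C) (Bᵀ * P * B - (Dᵀ + D)))).PosSemidef)
    (u : ℕ → Fin m → ℝ) (x : ℕ → Fin n → ℝ) (y : ℕ → Fin m → ℝ)
    (hx : ∀ k, x (k + 1) = A *ᵥ x k + B *ᵥ u k)
    (hy : ∀ k, y k = C *ᵥ x k + D *ᵥ u k) (T : ℕ) :
    (∑ k ∈ Finset.range (T + 1), (u k ⬝ᵥ y k + y k ⬝ᵥ u k) ≥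
      x (T + 1) ⬝ᵥ P *ᵥ x (T + 1) - x 0 ⬝ᵥ P *ᵥ x 0) ∧
    (x 0 = 0 →
      ∑ k ∈ Finset.range (T + 1), (u k ⬝ᵥ y k + y k ⬝ᵥ u k) ≥ 0) := by
  have dissipation (k : ℕ) : x (k + 1) ⬝ᵥ P *ᵥ x (k + 1) - x k ⬝ᵥ P *ᵥ x k ≤
      u k ⬝ᵥ y k + y k ⬝ᵥ u k := by
    have h := hLMI.dotProduct_mulVec_nonneg (Sum.elim (x k) (u k))
    rw [star_trivial, neg_mulVec, dotProduct_neg, dotProduct_kypMatrix_mulVec,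
      ← hx, ← hy] at h
    linarith
  have total : x (T + 1) ⬝ᵥ P *ᵥ x (T + 1) - x 0 ⬝ᵥ P *ᵥ x 0 ≤
      ∑ k ∈ Finset.range (T + 1), (u k ⬝ᵥ y k + y k ⬝ᵥ u k) := by
    rw [← Finset.sum_range_sub (fun k => x k ⬝ᵥ P *ᵥ x k)]
    exact Finset.sum_le_sum fun k _ => dissipation k
  refine ⟨total, fun h0 => ?_⟩
  have hT := hP.posSemidef.dotProduct_mulVec_nonneg (x (T + 1))
  rw [star_trivial] at hT
  rw [h0, zero_dotProduct, sub_zero] at total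
  exact hT.trans total
end

section
/- Let A, B, C, D be real matrices of sizes n×n, n×m, p×n, p×m respectively, let Q be a symmetric p×p real matrix, S a p×m real matrix, R a symmetric m×m real matrix, and let P be a symmetric positive definite n×n real matrix such that the block matrix [[AᵀPA − P − CᵀQC, AᵀPB − (CᵀS + CᵀQD)], [(AᵀPB − (CᵀS + CᵀQD))ᵀ, −DᵀQD − DᵀS − SᵀD − R + BᵀPB]] is negative semidefinite. Then for every input sequence u : ℕ → ℝ^m and every state trajectory x : ℕ → ℝ^n with x_{k+1} = A x_k + B u_k and output y_k = C x_k + D u_k, and for every T ∈ ℕ, Σ_{k=0}^{T} ( y_kᵀ Q y_k + 2 y_kᵀ S u_k + u_kᵀ R u_k ) ≥ x_{T+1}ᵀ P x_{T+1} − x₀ᵀ P x₀ ≥ −x₀ᵀ P x₀. -/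
open Matrix

theorem dotProduct_transpose_mulVec_eq {m n : Type*} [Fintype m] [Fintype n]
    (M : Matrix m n ℝ) (v : n → ℝ) (w : m → ℝ) : v ⬝ᵥ Mᵀ *ᵥ w = (M *ᵥ v) ⬝ᵥ w := by
  rw [dotProduct_mulVec, vecMul_transpose]

theorem Matrix.IsSymm.dotProduct_mulVec_swap {n : Type*} [Fintype n] {M : Matrix n n ℝ}
    (hM : M.IsSymm) (v w : n → ℝ) : v ⬝ᵥ M *ᵥ w = w ⬝ᵥ M *ᵥ v := by
  rw [dotProduct_comm, ← dotProduct_transpose_mulVec_eq, hM.eq]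

/-- The one-step dissipation inequality: the increase of the storage function `x ↦ xᵀ P x` is at
most the supply rate. -/
theorem storage_increment_le_supply {n m p : Type*} [Fintype n] [Fintype m] [Fintype p]
    {A : Matrix n n ℝ} {B : Matrix n m ℝ} {C : Matrix p n ℝ} {D : Matrix p m ℝ}
    {Q : Matrix p p ℝ} {S : Matrix p m ℝ} {R : Matrix m m ℝ} {P : Matrix n n ℝ}
    (hQ : Q.IsSymm) (hP : P.IsSymm)
    (hLMI : (-(Matrix.fromBlocks
        (Aᵀ * P * A - P - Cᵀ * Q * C) (Aᵀ * P * B - (Cᵀ * S + Cᵀ * Q * D))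
        (Aᵀ * P * B - (Cᵀ * S + Cᵀ * Q * D))ᵀ
        (-(Dᵀ * Q * D) - Dᵀ * S - Sᵀ * D - R + Bᵀ * P * B))).PosSemidef)
    (x : n → ℝ) (u : m → ℝ) :
    (A *ᵥ x + B *ᵥ u) ⬝ᵥ P *ᵥ (A *ᵥ x + B *ᵥ u) - x ⬝ᵥ P *ᵥ x ≤
      (C *ᵥ x + D *ᵥ u) ⬝ᵥ Q *ᵥ (C *ᵥ x + D *ᵥ u) + 2 * ((C *ᵥ x + D *ᵥ u) ⬝ᵥ S *ᵥ u) +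
        u ⬝ᵥ R *ᵥ u := by
  have h := hLMI.dotProduct_mulVec_nonneg (Sum.elim x u)
  rw [star_trivial, neg_mulVec, dotProduct_neg, fromBlocks_mulVec] at h
  simp only [sumElim_dotProduct_sumElim, Sum.elim_comp_inl, Sum.elim_comp_inr, transpose_sub,
    transpose_add, transpose_mul, transpose_transpose, hP.eq, hQ.eq, sub_mulVec, add_mulVec,
    neg_mulVec, ← mulVec_mulVec, dotProduct_add, dotProduct_sub, dotProduct_neg,
    dotProduct_transpose_mulVec_eq] at h
  simp only [mulVec_add, dotProduct_add, add_dotProduct]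
  linarith [hP.dotProduct_mulVec_swap (A *ᵥ x) (B *ᵥ u),
    hQ.dotProduct_mulVec_swap (C *ᵥ x) (D *ᵥ u),
    dotProduct_comm (S *ᵥ u) (C *ᵥ x), dotProduct_comm (S *ᵥ u) (D *ᵥ u)]

/-- Sufficiency direction of the discrete-time dissipativity lemma:
feasibility of the dissipativity LMI implies the QSR dissipation inequality
along every trajectory of the discrete LTI system `(A, B, C, D)`. -/
theorem discrete_dissipativity_lemma {n m p : ℕ}
    (A : Matrix (Fin n) (Fin n) ℝ) (B : Matrix (Fin n) (Fin m) ℝ)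
    (C : Matrix (Fin p) (Fin n) ℝ) (D : Matrix (Fin p) (Fin m) ℝ)
    (Q : Matrix (Fin p) (Fin p) ℝ) (S : Matrix (Fin p) (Fin m) ℝ)
    (R : Matrix (Fin m) (Fin m) ℝ)
    (hQ : Q.IsSymm) (hR : R.IsSymm)
    (P : Matrix (Fin n) (Fin n) ℝ) (hP : P.PosDef)
    (hLMI : (-(Matrix.fromBlocks
        (Aᵀ * P * A - P - Cᵀ * Q * C) (Aᵀ * P * B - (Cᵀ * S + Cᵀ * Q * D))
        (Aᵀ * P * B - (Cᵀ * S + Cᵀ * Q * D))ᵀ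
        (-(Dᵀ * Q * D) - Dᵀ * S - Sᵀ * D - R + Bᵀ * P * B))).PosSemidef)
    (u : ℕ → Fin m → ℝ) (x : ℕ → Fin n → ℝ) (y : ℕ → Fin p → ℝ)
    (hx : ∀ k, x (k + 1) = A *ᵥ x k + B *ᵥ u k)
    (hy : ∀ k, y k = C *ᵥ x k + D *ᵥ u k) (T : ℕ) :
    (∑ k ∈ Finset.range (T + 1),
        (y k ⬝ᵥ Q *ᵥ y k + 2 * (y k ⬝ᵥ S *ᵥ u k) + u k ⬝ᵥ R *ᵥ u k) ≥
      x (T + 1) ⬝ᵥ P *ᵥ x (T + 1) - x 0 ⬝ᵥ P *ᵥ x 0) ∧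
    (x (T + 1) ⬝ᵥ P *ᵥ x (T + 1) - x 0 ⬝ᵥ P *ᵥ x 0 ≥
      -(x 0 ⬝ᵥ P *ᵥ x 0)) := by
  have hPs : P.IsSymm := by simpa [IsHermitian, IsSymm] using hP.isHermitian
  refine ⟨?_, ?_⟩
  · rw [ge_iff_le, ← Finset.sum_range_sub (fun k => x k ⬝ᵥ P *ᵥ x k)]
    refine Finset.sum_le_sum fun k _ => ?_
    rw [hx, hy]
    exact storage_increment_le_supply hQ hPs hLMI (x k) (u k)
  · have h := hP.posSemidef.dotProduct_mulVec_nonneg (x (T + 1))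
    rw [star_trivial] at h
    linarith
end

section
/- Let A, B, C, D be real matrices of sizes n×n, n×m, p×n, p×m respectively, let Q be a symmetric negative definite p×p real matrix, S a p×m real matrix, R a symmetric m×m real matrix, and P a symmetric positive definite n×n real matrix. Then the 2×2 block matrix [[AᵀPA − P − CᵀQC, AᵀPB − (CᵀS + CᵀQD)], [(AᵀPB − (CᵀS + CᵀQD))ᵀ, −DᵀQD − DᵀS − SᵀD − R + BᵀPB]] is negative semidefinite if and only if the 4×4 block matrix [[−P, −CᵀS, Cᵀ, Aᵀ], [−SᵀC, −DᵀS − SᵀD − R, Dᵀ, Bᵀ], [C, D, Q⁻¹, 0], [A, B, 0, −P⁻¹]] is negative semidefinite. -/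
open Matrix

/-- A block diagonal real matrix with positive definite blocks is positive definite. -/
theorem posDef_fromBlocks_diagonal {k l : Type*} [Fintype k] [Fintype l] [DecidableEq k]
    [DecidableEq l] {M : Matrix k k ℝ} {N : Matrix l l ℝ} (hM : M.PosDef) (hN : N.PosDef) :
    (fromBlocks M 0 0 N).PosDef := by
  let := hM.isUnit.invertible
  have hsemi : (fromBlocks M 0 0 N).PosSemidef := by
    simpa using (PosDef.fromBlocks₁₁ 0 N hM).mpr (by simpa using hN.posSemidef)
  exact hsemi.posDef_iff_isUnit.mpr (isUnit_fromBlocks_zero₁₂.mpr ⟨hM.isUnit, hN.isUnit⟩)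

/-- Schur-complement equivalence (Corollary 1): the dissipativity matrix
inequality is equivalent to the expanded 4×4 block matrix inequality. -/
theorem dissipativity_schur_equivalence {n m p : ℕ}
    (A : Matrix (Fin n) (Fin n) ℝ) (B : Matrix (Fin n) (Fin m) ℝ)
    (C : Matrix (Fin p) (Fin n) ℝ) (D : Matrix (Fin p) (Fin m) ℝ)
    (Q : Matrix (Fin p) (Fin p) ℝ) (S : Matrix (Fin p) (Fin m) ℝ)
    (R : Matrix (Fin m) (Fin m) ℝ)
    (hQ : (-Q).PosDef) (hR : R.IsSymm)
    (P : Matrix (Fin n) (Fin n) ℝ) (hP : P.PosDef) :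
    (-(Matrix.fromBlocks
        (Aᵀ * P * A - P - Cᵀ * Q * C) (Aᵀ * P * B - (Cᵀ * S + Cᵀ * Q * D))
        (Aᵀ * P * B - (Cᵀ * S + Cᵀ * Q * D))ᵀ
        (-(Dᵀ * Q * D) - Dᵀ * S - Sᵀ * D - R + Bᵀ * P * B))).PosSemidef ↔
    (-(Matrix.fromBlocks
        (Matrix.fromBlocks (-P) (-(Cᵀ * S)) (-(Sᵀ * C)) (-(Dᵀ * S) - Sᵀ * D - R))
        (Matrix.fromBlocks Cᵀ Aᵀ Dᵀ Bᵀ)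
        (Matrix.fromBlocks C D A B)
        (Matrix.fromBlocks Q⁻¹ 0 0 (-P⁻¹)))).PosSemidef := by
  have hQt : Qᵀ = Q := by
    simpa [IsHermitian, conjTranspose_eq_transpose_of_trivial] using hQ.isHermitian
  have hPt : Pᵀ = P := by
    simpa [IsHermitian, conjTranspose_eq_transpose_of_trivial] using hP.isHermitian
  have hQdet : IsUnit Q.det := (isUnit_iff_isUnit_det Q).mp (by simpa using hQ.isUnit)
  have hPdet : IsUnit P.det := (isUnit_iff_isUnit_det P).mp hP.isUnit
  have hmul : fromBlocks (-Q⁻¹) 0 0 P⁻¹ * fromBlocks (-Q) 0 0 P = 1 := by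
    simp [fromBlocks_multiply, Q.nonsing_inv_mul hQdet, P.nonsing_inv_mul hPdet]
  have hW : (fromBlocks (-Q⁻¹) 0 0 P⁻¹).PosDef := by
    rw [← inv_eq_left_inv hmul]
    exact (posDef_fromBlocks_diagonal hQ hP).inv
  let := hW.isUnit.invertible
  have key := PosDef.fromBlocks₂₂ (fromBlocks P (Cᵀ * S) (Sᵀ * C) (Dᵀ * S + Sᵀ * D + R))
    (-fromBlocks Cᵀ Aᵀ Dᵀ Bᵀ) hW
  rw [inv_eq_right_inv hmul] at key
  convert! key.symm using 2
  · simp only [conjTranspose_eq_transpose_of_trivial, transpose_neg, fromBlocks_transpose,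
      transpose_transpose, Matrix.neg_mul, Matrix.mul_neg, neg_neg, fromBlocks_multiply,
      fromBlocks_neg, Matrix.mul_zero, add_zero, zero_add, sub_eq_add_neg, fromBlocks_add,
      transpose_add, transpose_mul, hQt, hPt, Matrix.mul_assoc]
    congr 1 <;> abel
  · simp only [conjTranspose_eq_transpose_of_trivial, transpose_neg, fromBlocks_transpose,
      transpose_transpose, fromBlocks_neg, neg_neg, neg_zero]
    congr 2
    abel
end

section
/- Let A, B, C, D be real matrices of sizes n×n, n×m, p×n, p×m respectively, let Q be a symmetric negative definite p×p real matrix, S a p×m real matrix, R a symmetric m×m real matrix, and let P and P̃ be symmetric positive definite n×n real matrices. If the 4×4 block matrix [[−P, −CᵀS, Cᵀ, Aᵀ], [−SᵀC, −DᵀS − SᵀD − R, Dᵀ, Bᵀ], [C, D, Q⁻¹, 0], [A, B, 0, −2P̃⁻¹ + P̃⁻¹ P P̃⁻¹]] is negative semidefinite, then the 4×4 block matrix [[−P, −CᵀS, Cᵀ, Aᵀ], [−SᵀC, −DᵀS − SᵀD − R, Dᵀ, Bᵀ], [C, D, Q⁻¹, 0], [A, B, 0, −P⁻¹]] is negative semidefinite.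 -/
open Matrix

theorem Matrix.PosSemidef.fromBlocks_zero_zero_zero {k l : Type*} [Fintype k] [Fintype l]
    {D : Matrix l l ℝ} (hD : D.PosSemidef) :
    (Matrix.fromBlocks (0 : Matrix k k ℝ) 0 0 D).PosSemidef := by
  classical
  have h := hD.conjTranspose_mul_mul_same (Matrix.fromCols (0 : Matrix l k ℝ) (1 : Matrix l l ℝ))
  rwa [Matrix.conjTranspose_fromCols_eq_fromRows_conjTranspose, Matrix.fromRows_mul,
    Matrix.mul_fromCols, Matrix.conjTranspose_zero, Matrix.conjTranspose_one, Matrix.zero_mul,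
    Matrix.one_mul, Matrix.mul_zero, Matrix.mul_one, ← Matrix.fromRows_zero,
    Matrix.fromCols_fromRows_eq_fromBlocks] at h

/-- The overbound gap `P⁻¹ - 2 K + K P K` is the congruence `(P⁻¹ - K) P (P⁻¹ - K)`. -/
theorem Matrix.PosDef.posSemidef_inv_sub_two_smul_add {ι : Type*} [Fintype ι] [DecidableEq ι]
    {P K : Matrix ι ι ℝ} (hP : P.PosDef) (hK : K.IsHermitian) :
    (P⁻¹ - (2 : ℝ) • K + K * P * K).PosSemidef := by
  have hdet : IsUnit P.det := (Matrix.isUnit_iff_isUnit_det P).mp hP.isUnit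
  have h := hP.posSemidef.conjTranspose_mul_mul_same (P⁻¹ - K)
  rw [Matrix.conjTranspose_sub, hP.inv.isHermitian.eq, hK.eq] at h
  have e : (P⁻¹ - K) * P * (P⁻¹ - K) = P⁻¹ - (2 : ℝ) • K + K * P * K := by
    simp only [sub_mul, mul_sub, Matrix.nonsing_inv_mul _ hdet, Matrix.mul_assoc,
      Matrix.mul_nonsing_inv _ hdet, Matrix.mul_one, Matrix.one_mul, two_smul]
    abel
  rwa [e] at h

/-- Feasibility of the convexified constraint (with `−P⁻¹` replaced by its
overbound `−2P̃⁻¹ + P̃⁻¹ P P̃⁻¹`) implies feasibility of the original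
constraint. -/
theorem convexified_implies_original {n m p : ℕ}
    (A : Matrix (Fin n) (Fin n) ℝ) (B : Matrix (Fin n) (Fin m) ℝ)
    (C : Matrix (Fin p) (Fin n) ℝ) (D : Matrix (Fin p) (Fin m) ℝ)
    (Q : Matrix (Fin p) (Fin p) ℝ) (S : Matrix (Fin p) (Fin m) ℝ)
    (R : Matrix (Fin m) (Fin m) ℝ)
    (hQ : (-Q).PosDef) (hR : R.IsSymm)
    (P Pt : Matrix (Fin n) (Fin n) ℝ) (hP : P.PosDef) (hPt : Pt.PosDef)
    (hconv : (-(Matrix.fromBlocks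
        (Matrix.fromBlocks (-P) (-(Cᵀ * S)) (-(Sᵀ * C)) (-(Dᵀ * S) - Sᵀ * D - R))
        (Matrix.fromBlocks Cᵀ Aᵀ Dᵀ Bᵀ)
        (Matrix.fromBlocks C D A B)
        (Matrix.fromBlocks Q⁻¹ 0 0
          (-((2 : ℝ) • Pt⁻¹) + Pt⁻¹ * P * Pt⁻¹)))).PosSemidef) :
    (-(Matrix.fromBlocks
        (Matrix.fromBlocks (-P) (-(Cᵀ * S)) (-(Sᵀ * C)) (-(Dᵀ * S) - Sᵀ * D - R))
        (Matrix.fromBlocks Cᵀ Aᵀ Dᵀ Bᵀ)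
        (Matrix.fromBlocks C D A B)
        (Matrix.fromBlocks Q⁻¹ 0 0 (-P⁻¹)))).PosSemidef := by
  convert hconv.add
    (hP.posSemidef_inv_sub_two_smul_add hPt.inv.isHermitian
      |>.fromBlocks_zero_zero_zero (k := Fin p)
      |>.fromBlocks_zero_zero_zero (k := Fin n ⊕ Fin m)) using 1
  simp only [Matrix.fromBlocks_neg, Matrix.fromBlocks_add, add_zero]
  congr 2
  abel
end

section
/- Let M be a symmetric n×n real matrix, let V₀ and δV be n×p real matrices, and let Z be a p×n real matrix. Set V = V₀ + δV and Γ(V) = ZᵀV₀ᵀδV Z + ZᵀδVᵀV₀ Z + ZᵀV₀ᵀV₀ Z. Then ZᵀVᵀV Z ≺ M if and only if the block matrix [[−M + Γ(V), ZᵀδVᵀ], [δV Z, −I]] (where I is the n×n identity) is negative definite. -/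
open Matrix

namespace Matrix

variable {m n : Type*} [Fintype m] [Fintype n]

theorem posDef_fromBlocks_zero_iff {A : Matrix m m ℝ} {D : Matrix n n ℝ} :
    (fromBlocks A 0 0 D).PosDef ↔ A.PosDef ∧ D.PosDef := by
  constructor
  · intro h
    exact ⟨h.submatrix Sum.inl_injective, h.submatrix Sum.inr_injective⟩
  · rintro ⟨hA, hD⟩
    refine .of_dotProduct_mulVec_pos (hA.1.fromBlocks (by simp) hD.1) fun x hx => ?_
    obtain ⟨y, z, rfl⟩ : ∃ y z, x = Sum.elim y z := ⟨_, _, (Sum.elim_comp_inl_inr x).symm⟩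
    have key : star (Sum.elim y z) ⬝ᵥ (fromBlocks A 0 0 D *ᵥ Sum.elim y z)
        = star y ⬝ᵥ (A *ᵥ y) + star z ⬝ᵥ (D *ᵥ z) := by
      simp [fromBlocks_mulVec]
    rw [key]
    by_cases hy : y = 0
    · have hz : z ≠ 0 := by
        rintro rfl
        exact hx (by simp [hy])
      simpa [hy] using hD.dotProduct_mulVec_pos hz
    · exact add_pos_of_pos_of_nonneg (hA.dotProduct_mulVec_pos hy)
        (hD.posSemidef.dotProduct_mulVec_nonneg z)

/-- Schur complement criterion for positive definiteness with identity lower-right block. -/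
theorem posDef_fromBlocks_one₂₂_iff [DecidableEq m] [DecidableEq n]
    (A : Matrix m m ℝ) (C : Matrix n m ℝ) :
    (fromBlocks A Cᵀ C (1 : Matrix n n ℝ)).PosDef ↔ (A - Cᵀ * C).PosDef := by
  have hU : IsUnit (fromBlocks (1 : Matrix m m ℝ) 0 C (1 : Matrix n n ℝ)) := by
    simp [isUnit_iff_isUnit_det]
  have hfactor : fromBlocks A Cᵀ C (1 : Matrix n n ℝ) =
      star (fromBlocks (1 : Matrix m m ℝ) 0 C (1 : Matrix n n ℝ)) *
        fromBlocks (A - Cᵀ * C) 0 0 1 * fromBlocks (1 : Matrix m m ℝ) 0 C 1 := by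
    simp [star_eq_conjTranspose, fromBlocks_transpose, fromBlocks_multiply]
  rw [hfactor, IsUnit.posDef_star_left_conjugate_iff hU, posDef_fromBlocks_zero_iff,
    and_iff_left PosDef.one]

end Matrix

/-- ICO overbound for the quadratic term `ZᵀVᵀVZ` (Lemma 4): with
`V = V₀ + δV` and `Γ(V) = ZᵀV₀ᵀδVZ + ZᵀδVᵀV₀Z + ZᵀV₀ᵀV₀Z`, the bound
`ZᵀVᵀVZ ≺ M` holds iff the block matrix
`[[−M + Γ(V), ZᵀδVᵀ], [δVZ, −I]]` is negative definite. -/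
theorem ico_quadratic_overbound {n p : ℕ}
    (M : Matrix (Fin n) (Fin n) ℝ) (hM : M.IsSymm)
    (V₀ δV : Matrix (Fin n) (Fin p) ℝ) (Z : Matrix (Fin p) (Fin n) ℝ) :
    (M - Zᵀ * (V₀ + δV)ᵀ * (V₀ + δV) * Z).PosDef ↔
    (-(Matrix.fromBlocks
        (-M + (Zᵀ * V₀ᵀ * δV * Z + Zᵀ * δVᵀ * V₀ * Z + Zᵀ * V₀ᵀ * V₀ * Z))
        (Zᵀ * δVᵀ)
        (δV * Z)
        (-(1 : Matrix (Fin n) (Fin n) ℝ)))).PosDef := by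
  have hblock : -(fromBlocks
        (-M + (Zᵀ * V₀ᵀ * δV * Z + Zᵀ * δVᵀ * V₀ * Z + Zᵀ * V₀ᵀ * V₀ * Z))
        (Zᵀ * δVᵀ) (δV * Z) (-(1 : Matrix (Fin n) (Fin n) ℝ))) =
      fromBlocks (M - (Zᵀ * V₀ᵀ * δV * Z + Zᵀ * δVᵀ * V₀ * Z + Zᵀ * V₀ᵀ * V₀ * Z))
        (-(δV * Z))ᵀ (-(δV * Z)) 1 := by
    rw [fromBlocks_neg, neg_neg, transpose_neg, transpose_mul, neg_add, neg_neg, ← sub_eq_add_neg]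
  rw [hblock, posDef_fromBlocks_one₂₂_iff]
  congr! 1
  simp only [transpose_add, transpose_neg, transpose_mul, Matrix.mul_add, Matrix.add_mul,
    Matrix.neg_mul, Matrix.mul_neg, neg_neg, Matrix.mul_assoc]
  abel
end

section
/- Let M be a symmetric n×n real matrix, U₀ and δU m×n real matrices, V₀ and δV n×p real matrices, Z a p×n real matrix, and W a symmetric positive definite n×n real matrix. Set U = U₀ + δU, V = V₀ + δV, and Γ(V,U) = Zᵀ( V₀ᵀU₀ᵀU₀V₀ + V₀ᵀU₀ᵀδU V₀ + V₀ᵀU₀ᵀU₀ δV + δVᵀU₀ᵀU₀ V₀ + V₀ᵀδUᵀ U₀ V₀ ) Z. If the block matrix whose upper-left 2×2 block structure is [[−M + Γ(V,U), Zᵀ(δVᵀU₀ᵀ + V₀ᵀδUᵀ)], [(δU V₀ + U₀ δV) Z, −I]] (with I the m×m identity), bordered by the additional column blocks [ZᵀV₀ᵀU₀ᵀ δU; δU] and [ZᵀδVᵀ; 0] with corresponding diagonal blocks −W⁻¹ and −W (and zero off-diagonal block between the two borders), is negative definite, then ZᵀVᵀUᵀU V Z ≺ M. -/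
open Matrix

theorem Matrix.fromCols_add_fromCols {α m n₁ n₂ : Type*} [Add α]
    (A₁ B₁ : Matrix m n₁ α) (A₂ B₂ : Matrix m n₂ α) :
    fromCols A₁ A₂ + fromCols B₁ B₂ = fromCols (A₁ + B₁) (A₂ + B₂) := by
  ext i (j | j) <;> rfl

/-- ICO overbound for the quartic term `ZᵀVᵀUᵀUVZ` (Lemma 7): negative
definiteness of the displayed bordered block matrix implies
`ZᵀVᵀUᵀUVZ ≺ M`, where `U = U₀ + δU`, `V = V₀ + δV`, and
`Γ(V,U) = Zᵀ(V₀ᵀU₀ᵀU₀V₀ + V₀ᵀU₀ᵀδUV₀ + V₀ᵀU₀ᵀU₀δV + δVᵀU₀ᵀU₀V₀ +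
V₀ᵀδUᵀU₀V₀)Z`. -/
theorem ico_quartic_overbound {m n p : ℕ}
    (M : Matrix (Fin n) (Fin n) ℝ) (hM : M.IsSymm)
    (U₀ δU : Matrix (Fin m) (Fin n) ℝ)
    (V₀ δV : Matrix (Fin n) (Fin p) ℝ)
    (Z : Matrix (Fin p) (Fin n) ℝ)
    (W : Matrix (Fin n) (Fin n) ℝ) (hW : W.PosDef)
    (hLMI : (-(Matrix.fromBlocks
        (Matrix.fromBlocks
          (-M + Zᵀ * (V₀ᵀ * U₀ᵀ * U₀ * V₀ + V₀ᵀ * U₀ᵀ * δU * V₀ +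
            V₀ᵀ * U₀ᵀ * U₀ * δV + δVᵀ * U₀ᵀ * U₀ * V₀ +
            V₀ᵀ * δUᵀ * U₀ * V₀) * Z)
          (Zᵀ * (δVᵀ * U₀ᵀ + V₀ᵀ * δUᵀ))
          ((δU * V₀ + U₀ * δV) * Z)
          (-(1 : Matrix (Fin m) (Fin m) ℝ)))
        (Matrix.fromBlocks (Zᵀ * V₀ᵀ * U₀ᵀ * δU) (Zᵀ * δVᵀ) δU 0)
        (Matrix.fromBlocks (Zᵀ * V₀ᵀ * U₀ᵀ * δU) (Zᵀ * δVᵀ) δU 0)ᵀ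
        (Matrix.fromBlocks (-W⁻¹) 0 0 (-W)))).PosDef) :
    (M - Zᵀ * (V₀ + δV)ᵀ * (U₀ + δU)ᵀ * (U₀ + δU) * (V₀ + δV) * Z).PosDef := by
  have hWt : W⁻¹ᵀ = W⁻¹ := by
    have h := hW.1
    rw [Matrix.IsHermitian, conjTranspose_eq_transpose_of_trivial] at h
    rw [transpose_nonsing_inv, h]
  have hWW : W * W⁻¹ = 1 := mul_nonsing_inv W ((isUnit_iff_isUnit_det W).mp hW.isUnit)
  have hWc : ∀ X : Matrix (Fin n) (Fin n) ℝ, W * (W⁻¹ * X) = X := fun X => by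
    rw [← Matrix.mul_assoc, hWW, Matrix.one_mul]
  let K := fromRows
    (fromRows (1 : Matrix (Fin n) (Fin n) ℝ)
      ((δU * V₀ + U₀ * δV + δU * δV) * Z))
    (fromRows (δV * Z) (W⁻¹ * (δV * Z)))
  have hK : Function.Injective K.mulVec := by
    intro x y hxy
    funext i
    have h := congrFun hxy (Sum.inl (Sum.inl i))
    simpa [K, fromRows_mulVec] using h
  have key := hLMI.conjTranspose_mul_mul_same hK
  convert key using 1
  simp only [K, conjTranspose_eq_transpose_of_trivial, transpose_fromRows, fromBlocks_neg,
    fromBlocks_transpose, fromCols_mul_fromBlocks, fromCols_mul_fromRows,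
    Matrix.mul_add, Matrix.add_mul, Matrix.mul_assoc, transpose_add, transpose_mul, transpose_one,
    Matrix.one_mul, Matrix.mul_one, Matrix.neg_mul, Matrix.mul_neg, neg_add, neg_neg, neg_zero,
    transpose_transpose, transpose_zero, Matrix.mul_zero, hWt, hWc,
    fromCols_add_fromCols, add_zero, zero_add]
  abel
end
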